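/- arXiv:2511.11042 — 6 statements merged into one kernel-verified Lean document; each statement's English description precedes it below -/
import Mathlib

section
/- Let λ ≥ 0 and let c_M, c_N : ℝ → ℝ² be differentiable curves satisfying c_M'(t) = c_N'(t) + λ·(c_M(t) − c_N(t)) for all t, with admissible initial configuration ‖c_M(0) − c_N(0)‖ ≥ 2. Then ‖c_M(t) − c_N(t)‖ ≥ 2 for all t ≥ 0; i.e. the infinitesimal motion algorithm v_M = v_N + λ(c_M − c_N) with λ ≥ 0 (in particular with λ ≥ 1) guarantees safety of M regardless of the behaviour of N. -/
/-- A curve whose velocity is a nonnegative multiple of its position has nondecreasing norm. -/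
theorem monotone_norm_of_hasDerivAt_smul {E : Type*} [NormedAddCommGroup E]
    [InnerProductSpace ℝ E] {c : ℝ} (hc : 0 ≤ c) {f : ℝ → E}
    (hf : ∀ t, HasDerivAt f (c • f t) t) : Monotone fun t => ‖f t‖ := by
  have hsq : ∀ t, HasDerivAt (fun s => ‖f s‖ ^ 2) (2 * inner ℝ (f t) (c • f t)) t :=
    fun t => (hf t).norm_sq
  have hmono : Monotone fun t => ‖f t‖ ^ 2 := by
    refine monotone_of_deriv_nonneg (fun t => (hsq t).differentiableAt) fun t => ?_
    rw [(hsq t).deriv, real_inner_smul_right, real_inner_self_eq_norm_sq]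
    positivity
  exact fun s t hst => (sq_le_sq₀ (norm_nonneg _) (norm_nonneg _)).1 (hmono hst)

/-- The infinitesimal motion algorithm `v_M = v_N + λ (c_M - c_N)`
with `λ ≥ 0` guarantees safety: if the initial configuration is admissible
(`‖c_M 0 - c_N 0‖ ≥ 2`) then the configuration stays admissible for all `t ≥ 0`,
regardless of the behaviour of `N`. -/
theorem stmt_2 (lam : ℝ) (hlam : 0 ≤ lam) (cM cN : ℝ → EuclideanSpace ℝ (Fin 2))
    (hM : Differentiable ℝ cM) (hN : Differentiable ℝ cN)
    (h : ∀ t : ℝ, deriv cM t = deriv cN t + lam • (cM t - cN t))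
    (hinit : 2 ≤ ‖cM 0 - cN 0‖) :
    ∀ t : ℝ, 0 ≤ t → 2 ≤ ‖cM t - cN t‖ := by
  have hd : ∀ t, HasDerivAt (fun s => cM s - cN s) (lam • (cM t - cN t)) t := fun t => by
    have hsub := (hM t).hasDerivAt.sub (hN t).hasDerivAt
    rwa [h t, add_sub_cancel_left] at hsub
  exact fun t ht => hinit.trans (monotone_norm_of_hasDerivAt_smul hlam hd ht)
end

section
/- Let α, β ∈ ℝ with (α, β) ≠ (1, 0), let A = αI + βJ and B = A − I. Then det B = (α−1)² + β² > 0, so B is invertible; and if c_M, c_N : ℝ → ℝ² are differentiable curves with c_M'(t) = A(c_N'(t)) for all t, then c_M(t) − c_N(t) = B(c_N(t) − c̃₀) for all t, where c̃₀ = (I + B⁻¹)(c_N(0)) − B⁻¹(c_M(0)). -/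
/-- `Jlin` : rotation of the Euclidean plane by 90 degrees in the positive
direction, `J(x, y) = (-y, x)`, as a linear map. -/
noncomputable def Jlin : EuclideanSpace ℝ (Fin 2) →ₗ[ℝ] EuclideanSpace ℝ (Fin 2) :=
  Matrix.toEuclideanLin !![0, -1; 1, 0]

/-- `Amech α β = α I + β J` : the general linear infinitesimal reaction
mechanism with constant coefficients. -/
noncomputable def Amech (α β : ℝ) :
    EuclideanSpace ℝ (Fin 2) →ₗ[ℝ] EuclideanSpace ℝ (Fin 2) :=
  α • LinearMap.id + β • Jlin

/-- `Bmech α β = A - I` where `A = α I + β J`. -/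
noncomputable def Bmech (α β : ℝ) :
    EuclideanSpace ℝ (Fin 2) →ₗ[ℝ] EuclideanSpace ℝ (Fin 2) :=
  Amech α β - LinearMap.id

theorem Bmech_eq_toLin (α β : ℝ) :
    Bmech α β = Matrix.toLin (EuclideanSpace.basisFun (Fin 2) ℝ).toBasis
      (EuclideanSpace.basisFun (Fin 2) ℝ).toBasis !![α - 1, -β; β, α - 1] := by
  rw [← Matrix.toEuclideanLin_eq_toLin_orthonormal]
  ext x i
  fin_cases i <;>
    simp [Bmech, Amech, Jlin, Matrix.toLpLin_apply, dotProduct,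
      Fin.sum_univ_two] <;> ring

theorem det_Bmech (α β : ℝ) : LinearMap.det (Bmech α β) = (α - 1) ^ 2 + β ^ 2 := by
  rw [Bmech_eq_toLin, LinearMap.det_toLin, Matrix.det_fin_two_of]
  ring

theorem sq_add_sq_pos_of_ne {α β : ℝ} (h : (α, β) ≠ (1, 0)) : 0 < (α - 1) ^ 2 + β ^ 2 := by
  by_contra! hle
  have hα : α - 1 = 0 := by nlinarith [sq_nonneg (α - 1), sq_nonneg β]
  have hβ : β = 0 := by nlinarith [sq_nonneg (α - 1), sq_nonneg β]
  exact h (Prod.ext (sub_eq_zero.mp hα) hβ)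

/-- If `f' = L ∘ g'` for a linear map `L` on a finite-dimensional space, then `f - L ∘ g` is
constant. -/
theorem sub_map_eq_of_deriv_eq {E F : Type*} [NormedAddCommGroup E] [NormedSpace ℝ E]
    [FiniteDimensional ℝ E] [NormedAddCommGroup F] [NormedSpace ℝ F] (L : E →ₗ[ℝ] F)
    {f : ℝ → F} {g : ℝ → E} (hf : Differentiable ℝ f) (hg : Differentiable ℝ g)
    (h : ∀ t, deriv f t = L (deriv g t)) (s t : ℝ) : f s - L (g s) = f t - L (g t) := by
  have hd (r : ℝ) : HasDerivAt (fun u => f u - L (g u)) 0 r := by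
    have hL := L.toContinuousLinearMap.hasFDerivAt.comp_hasDerivAt r (hg r).hasDerivAt
    have := (hf r).hasDerivAt.sub hL
    rw [h r, LinearMap.coe_toContinuousLinearMap', sub_self] at this
    exact this
  exact is_const_of_deriv_eq_zero (fun r => (hd r).differentiableAt) (fun r => (hd r).deriv) s t

/-- For `(α, β) ≠ (1, 0)`, with `A = α I + β J` and `B = A - I`,
one has `det B = (α-1)² + β² > 0`, so `B` is invertible (bijective); and for
any curves with `c_M' = A ∘ c_N'` one has `c_M(t) - c_N(t) = B (c_N(t) - c̃₀)`
where `c̃₀ = (I + B⁻¹)(c_N 0) - B⁻¹ (c_M 0)`. -/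
theorem stmt_5 (α β : ℝ) (hαβ : (α, β) ≠ (1, 0)) :
    LinearMap.det (Bmech α β) = (α - 1) ^ 2 + β ^ 2 ∧
    0 < (α - 1) ^ 2 + β ^ 2 ∧
    Function.Bijective (Bmech α β) ∧
    (∀ Binv : EuclideanSpace ℝ (Fin 2) →ₗ[ℝ] EuclideanSpace ℝ (Fin 2),
      Binv.comp (Bmech α β) = LinearMap.id →
      (Bmech α β).comp Binv = LinearMap.id →
      ∀ cM cN : ℝ → EuclideanSpace ℝ (Fin 2),
        Differentiable ℝ cM → Differentiable ℝ cN →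
        (∀ t : ℝ, deriv cM t = Amech α β (deriv cN t)) →
        ∀ t : ℝ, cM t - cN t =
          Bmech α β (cN t - (cN 0 + Binv (cN 0) - Binv (cM 0)))) := by
  have hpos := sq_add_sq_pos_of_ne hαβ
  refine ⟨det_Bmech α β, hpos, ?_, ?_⟩
  · rw [← Module.End.isUnit_iff, LinearMap.isUnit_iff_isUnit_det, det_Bmech]
    exact hpos.ne'.isUnit
  · intro Binv _ hright cM cN hM hN hderiv t
    have hB (x) : Bmech α β (Binv x) = x := LinearMap.congr_fun hright x
    have hA (x) : Bmech α β x = Amech α β x - x := rfl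
    have hconst := sub_map_eq_of_deriv_eq (Amech α β) hM hN hderiv t 0
    simp only [map_sub, map_add, hB]
    rw [hA, hA, sub_eq_iff_eq_add.mp hconst]
    abel
end

section
/- Let α, β ∈ ℝ with (α, β) ≠ (1, 0) and A = αI + βJ. For any initial positions c_M0, c_N0 ∈ ℝ² there exists a continuously differentiable path c_N : [0,1] → ℝ² with c_N(0) = c_N0 such that the induced trajectory of the ego vehicle, c_M(t) = A(c_N(t)) − (A(c_N0) − c_M0) (i.e. the trajectory produced by the reaction mechanism v_M = A(v_N) with initial position c_M0), satisfies ‖c_M(1) − c_N(1)‖ < 2. In other words, if M employs any linear infinitesimal reaction mechanism with constant coefficients other than v_M = v_N, the other vehicle N is always capable of forcing a collision. -/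
theorem Jlin_Jlin (v : EuclideanSpace ℝ (Fin 2)) : Jlin (Jlin v) = -v := by
  ext i
  fin_cases i <;> simp [Jlin, Matrix.toLpLin_apply, dotProduct]

/-- `A - I` is surjective as soon as `A = α I + β J` is not the identity. -/
theorem exists_Amech_sub_eq {α β : ℝ} (hαβ : (α, β) ≠ (1, 0))
    (u : EuclideanSpace ℝ (Fin 2)) : ∃ w, Amech α β w - w = u := by
  have hd : (α - 1) ^ 2 + β ^ 2 ≠ 0 := by
    intro h
    have hα : α - 1 = 0 := by nlinarith [sq_nonneg (α - 1), sq_nonneg β]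
    have hβ : β = 0 := by nlinarith [sq_nonneg (α - 1), sq_nonneg β]
    exact hαβ (Prod.ext (sub_eq_zero.mp hα) hβ)
  refine ⟨((α - 1) ^ 2 + β ^ 2)⁻¹ • ((α - 1) • u - β • Jlin u), ?_⟩
  simp only [Amech, LinearMap.add_apply, LinearMap.smul_apply, LinearMap.id_apply, map_smul,
    map_sub, Jlin_Jlin]
  match_scalars <;> field_simp <;> ring

/-- If the ego vehicle `M` employs any linear infinitesimal
reaction mechanism with constant coefficients `v_M = A(v_N)`, `A = α I + β J`,
other than `v_M = v_N` (i.e. `(α, β) ≠ (1, 0)`), then for any initial positions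
the other vehicle `N` can force a collision: there is a continuously
differentiable path `c_N` with `c_N(0) = c_N0` whose induced ego trajectory
`c_M(t) = A(c_N(t)) - (A(c_N0) - c_M0)` satisfies `‖c_M(1) - c_N(1)‖ < 2`. -/
theorem stmt_8 (α β : ℝ) (hαβ : (α, β) ≠ (1, 0))
    (cM0 cN0 : EuclideanSpace ℝ (Fin 2)) :
    ∃ cN : ℝ → EuclideanSpace ℝ (Fin 2),
      ContDiff ℝ 1 cN ∧ cN 0 = cN0 ∧
      ‖(Amech α β (cN 1) - (Amech α β cN0 - cM0)) - cN 1‖ < 2 := by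
  obtain ⟨w, hw⟩ := exists_Amech_sub_eq hαβ (cN0 - cM0)
  refine ⟨fun t => cN0 + t • w, by fun_prop, by simp, ?_⟩
  have hzero : Amech α β (cN0 + (1 : ℝ) • w) - (Amech α β cN0 - cM0) - (cN0 + (1 : ℝ) • w)
      = 0 := by
    rw [one_smul, map_add, ← sub_eq_zero.mpr hw]
    abel
  dsimp only
  rw [hzero, norm_zero]
  exact two_pos
end

section
/- Let p : E → B be a continuous map, L a lifting function for p, U ⊆ E²_B, s : U → C(I,E) a parametrised motion planning algorithm on U, and φ : I → I a continuous function with φ(0) = 0 and φ(1) = 1. For every triple (γ, e, e') with γ ∈ C(I,B), (e,e') ∈ U and p(e) = p(e') = γ(0), define γ̃(t) = L(s(e,e')(φ(t)), γ)(t). Then γ̃ is a continuous path in E satisfying p(γ̃(t)) = γ(t) for all t ∈ I, γ̃(0) = e, and γ̃(1) = L(e',γ)(1). -/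
open unitInterval

/-- With `p`, a lifting function `L`, a parametrised motion
planning algorithm `s` on `U ⊆ E²_B`, and a continuous reparametrisation
`φ : I → I` with `φ 0 = 0`, `φ 1 = 1`, the path
`γ̃(t) = L(s(e,e')(φ(t)), γ)(t)` (for `(e,e') ∈ U`, `p e = p e' = γ 0`)
is a continuous path in `E` with `p(γ̃(t)) = γ(t)`, `γ̃(0) = e` and
`γ̃(1) = L(e',γ)(1)`. -/
theorem stmt_13 {E B : Type*} [TopologicalSpace E] [TopologicalSpace B]
    (p : E → B) (hp : Continuous p)
    -- the lifting function L
    (L : E × C(I, B) → C(I, E))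
    (hLcont : ContinuousOn L {q | p q.1 = q.2 0})
    (hL0 : ∀ q : E × C(I, B), p q.1 = q.2 0 → L q 0 = q.1)
    (hLp : ∀ q : E × C(I, B), p q.1 = q.2 0 → ∀ t : I, p (L q t) = q.2 t)
    -- the parametrised motion planning algorithm s on U ⊆ E²_B
    (U : Set (E × E)) (hU : U ⊆ {q : E × E | p q.1 = p q.2})
    (s : E × E → C(I, E)) (hscont : ContinuousOn s U)
    (hs0 : ∀ q ∈ U, s q 0 = q.1)
    (hs1 : ∀ q ∈ U, s q 1 = q.2)
    (hsp : ∀ q ∈ U, ∀ t : I, p (s q t) = p q.1)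
    -- the reparametrisation φ
    (φ : I → I) (hφ : Continuous φ) (hφ0 : φ 0 = 0) (hφ1 : φ 1 = 1)
    -- the input data: a path γ of external conditions and states e, e'
    (γ : C(I, B)) (e e' : E) (heU : (e, e') ∈ U) (hγ0 : γ 0 = p e)
    -- the path γ̃
    (γt : I → E)
    (hdef : ∀ t : I, γt t = L (s (e, e') (φ t), γ) t) :
    Continuous γt ∧
    (∀ t : I, p (γt t) = γ t) ∧
    γt 0 = e ∧
    γt 1 = L (e', γ) 1 := by
  have hmem : ∀ t : I, p (s (e, e') (φ t)) = γ 0 := fun t => (hsp _ heU _).trans hγ0.symm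
  refine ⟨?_, fun t => ?_, ?_, ?_⟩
  · have hc : Continuous fun t : I => L (s (e, e') (φ t), γ) :=
      hLcont.comp_continuous (by fun_prop) hmem
    rw [funext hdef]
    exact continuous_eval.comp (hc.prodMk continuous_id)
  · rw [hdef, hLp _ (hmem t)]
  · rw [hdef, hL0 _ (hmem 0), hφ0, hs0 _ heU]
  · rw [hdef, hφ1, hs1 _ heU]
end

section
/- Let p : E → B be a continuous map, L a lifting function for p, and Z = {(γ,e,e') ∈ C(I,B) × E × E : p(e) = p(e') = γ(0)} with the subspace topology. Let j : E²_B → Z be the map j(e,e') = (const_{p(e)}, e, e'), where const_b denotes the constant path at b; then j is continuous. Suppose W ⊆ Z is open and σ : W → C(I,E) is a continuous map such that for every (γ,e,e') ∈ W: p ∘ σ(γ,e,e') = γ, σ(γ,e,e')(0) = e, and σ(γ,e,e')(1) = L(e',γ)(1). Then V = j⁻¹(W) is open in E²_B, and the map assigning to (e,e') ∈ V the concatenation of the path σ(j(e,e')) with the reverse of the path L(e', const_{p(e)}) is a parametrised motion planning algorithm on V: it is continuous as a map V → C(I,E), and for each (e,e') ∈ V it yields a path δ in E with p ∘ δ constant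 equal to p(e), δ(0) = e, and δ(1) = e'. (This is the direction of Theorem 3.4 showing that the parametrised topological complexity TC[p : E → B] is at most the complexity of the extended problem, since the extended fibration contains the parametrised one as its restriction to constant paths.) -/
open unitInterval

/-- Two continuous families of paths with common endpoints can be concatenated, the second one
being reversed, to a continuous family of paths. -/
theorem exists_continuousMap_concat_reverse {X E : Type*} [TopologicalSpace X]
    [TopologicalSpace E] (f g : C(X, C(I, E))) (h : ∀ x, f x 1 = g x 1) :
    ∃ F : C(X, C(I, E)), ∀ x,
      (∀ t : I, (t : ℝ) ≤ 1 / 2 → ∀ t₂ : I, (t₂ : ℝ) = 2 * (t : ℝ) → F x t = f x t₂) ∧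
      (∀ t : I, 1 / 2 ≤ (t : ℝ) → ∀ t₂ : I, (t₂ : ℝ) = 2 - 2 * (t : ℝ) → F x t = g x t₂) := by
  have proj_eq (r : ℝ) (t₂ : I) (ht₂ : (t₂ : ℝ) = r) :
      Set.projIcc (0 : ℝ) 1 zero_le_one r = t₂ := by
    rw [← ht₂, Set.projIcc_val]
  have proj_one (r : ℝ) (hr : r = 1) : Set.projIcc (0 : ℝ) 1 zero_le_one r = 1 :=
    proj_eq r 1 (by simp [hr])
  have hcont : Continuous fun y : X × I =>
      if (y.2 : ℝ) ≤ 1 / 2 then f y.1 (Set.projIcc (0 : ℝ) 1 zero_le_one (2 * (y.2 : ℝ)))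
      else g y.1 (Set.projIcc (0 : ℝ) 1 zero_le_one (2 - 2 * (y.2 : ℝ))) := by
    refine Continuous.if_le ?_ ?_ (by fun_prop) continuous_const ?_
    · exact (f.continuous.comp continuous_fst).eval (continuous_projIcc.comp (by fun_prop))
    · exact (g.continuous.comp continuous_fst).eval (continuous_projIcc.comp (by fun_prop))
    · intro y hy
      rw [proj_one _ (by linarith), proj_one _ (by linarith), h]
  refine ⟨ContinuousMap.curry ⟨_, hcont⟩, fun x => ⟨fun t ht t₂ ht₂ => ?_, fun t ht t₂ ht₂ => ?_⟩⟩
  · simp only [ContinuousMap.curry_apply, ContinuousMap.coe_mk, if_pos ht, proj_eq _ t₂ ht₂]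
  · rcases ht.eq_or_lt with ht' | ht'
    · have h₁ : t₂ = 1 := Subtype.ext (by rw [ht₂, ← ht']; norm_num)
      simp only [ContinuousMap.curry_apply, ContinuousMap.coe_mk, if_pos ht'.ge]
      rw [proj_one _ (by linarith), h₁, h]
    · simp only [ContinuousMap.curry_apply, ContinuousMap.coe_mk, if_neg ht'.not_ge,
        proj_eq _ t₂ ht₂]

/-- Let `p : E → B` be continuous with lifting function `L`,
`Z = {(γ,e,e') : p e = p e' = γ 0}`, and let `j : E²_B → Z`,
`j(e,e') = (const_{p e}, e, e')`.  Then `j` is continuous.  If `W ⊆ Z` is open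
in `Z` and `σ : W → C(I,E)` is a continuous section of the extended problem
(`p ∘ σ(γ,e,e') = γ`, `σ(γ,e,e')(0) = e`, `σ(γ,e,e')(1) = L(e',γ)(1)`), then
`V = j⁻¹(W)` is open in `E²_B` and the concatenation of `σ(j(e,e'))` with the
reverse of `L(e', const_{p e})` is a parametrised motion planning algorithm on
`V`. -/
theorem stmt_15 {E B : Type*} [TopologicalSpace E] [TopologicalSpace B]
    (p : E → B) (hp : Continuous p)
    -- the lifting function L
    (L : E × C(I, B) → C(I, E))
    (hLcont : ContinuousOn L {q | p q.1 = q.2 0})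
    (hL0 : ∀ q : E × C(I, B), p q.1 = q.2 0 → L q 0 = q.1)
    (hLp : ∀ q : E × C(I, B), p q.1 = q.2 0 → ∀ t : I, p (L q t) = q.2 t)
    -- the spaces E²_B and Z
    (E2B : Set (E × E)) (hE2B : E2B = {q : E × E | p q.1 = p q.2})
    (Z : Set (C(I, B) × E × E))
    (hZ : Z = {z | p z.2.1 = p z.2.2 ∧ z.1 0 = p z.2.1})
    -- the map j sending (e,e') to (const_{p e}, e, e')
    (j : E × E → C(I, B) × E × E)
    (hj : ∀ q : E × E, j q = (ContinuousMap.const I (p q.1), q.1, q.2))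
    -- W ⊆ Z open, with a continuous section sig of the extended problem on W
    (W : Set (C(I, B) × E × E)) (hWsub : W ⊆ Z)
    (hWopen : ∃ O, IsOpen O ∧ W = Z ∩ O)
    (sig : C(I, B) × E × E → C(I, E))
    (hsigcont : ContinuousOn sig W)
    (hsigp : ∀ z ∈ W, ∀ t : I, p (sig z t) = z.1 t)
    (hsig0 : ∀ z ∈ W, sig z 0 = z.2.1)
    (hsig1 : ∀ z ∈ W, sig z 1 = L (z.2.2, z.1) 1) :
    -- j is continuous (on E²_B) and maps E²_B into Z
    ContinuousOn j E2B ∧ (∀ q ∈ E2B, j q ∈ Z) ∧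
    -- V = j⁻¹(W) is open in E²_B
    (∃ O, IsOpen O ∧ E2B ∩ j ⁻¹' W = E2B ∩ O) ∧
    -- the concatenation of sig (j (e,e')) and the reverse of L(e', const_{p e})
    -- is a parametrised motion planning algorithm on V
    (∃ sV : E × E → C(I, E),
      ContinuousOn sV (E2B ∩ j ⁻¹' W) ∧
      ∀ q ∈ E2B ∩ j ⁻¹' W,
        -- first half: sig (j q) traversed at double speed
        (∀ t : I, (t : ℝ) ≤ 1 / 2 → ∀ t₂ : I, (t₂ : ℝ) = 2 * (t : ℝ) →
          sV q t = sig (j q) t₂) ∧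
        -- second half: the reverse of L(e', const_{p e}) at double speed
        (∀ t : I, 1 / 2 ≤ (t : ℝ) → ∀ t₂ : I, (t₂ : ℝ) = 2 - 2 * (t : ℝ) →
          sV q t = L (q.2, ContinuousMap.const I (p q.1)) t₂) ∧
        -- it is a motion planning algorithm: projects to the constant path...
        (∀ t : I, p (sV q t) = p q.1) ∧
        -- ...starts at e and ends at e'
        sV q 0 = q.1 ∧ sV q 1 = q.2) := by
  have hjcont : Continuous j := by
    rw [funext hj]
    exact (ContinuousMap.continuous_const'.comp (hp.comp continuous_fst)).prodMk
      (continuous_fst.prodMk continuous_snd)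
  have hjZ : ∀ q ∈ E2B, j q ∈ Z := by
    intro q hq
    subst hE2B hZ
    rw [hj]
    exact ⟨hq, rfl⟩
  refine ⟨hjcont.continuousOn, hjZ, ?_, ?_⟩
  · obtain ⟨O, hO, rfl⟩ := hWopen
    refine ⟨j ⁻¹' O, hO.preimage hjcont, ?_⟩
    ext q
    exact ⟨fun hq => ⟨hq.1, hq.2.2⟩, fun hq => ⟨hq.1, hjZ q hq.1, hq.2⟩⟩
  set V := E2B ∩ j ⁻¹' W
  have hpV : ∀ q ∈ V, p q.2 = p q.1 := by
    intro q hq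
    have := hq.1
    rw [hE2B] at this
    exact this.symm
  have hf : ContinuousOn (fun q => sig (j q)) V :=
    hsigcont.comp hjcont.continuousOn fun q hq => hq.2
  have hg : ContinuousOn (fun q : E × E => L (q.2, ContinuousMap.const I (p q.1))) V := by
    refine hLcont.comp (Continuous.continuousOn ?_) hpV
    exact continuous_snd.prodMk
      (ContinuousMap.continuous_const'.comp (hp.comp continuous_fst))
  obtain ⟨F, hF⟩ := exists_continuousMap_concat_reverse
    ⟨_, hf.domRestrict⟩ ⟨_, hg.domRestrict⟩ (fun q => by
      have := hsig1 _ q.2.2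
      simpa [hj] using this)
  classical
  let sV : E × E → C(I, E) := fun q =>
    if h : q ∈ V then F ⟨q, h⟩ else ContinuousMap.const I q.1
  have hsV (q : E × E) (h : q ∈ V) : sV q = F ⟨q, h⟩ := dif_pos h
  refine ⟨sV, ?_, fun q hq => ?_⟩
  · rw [continuousOn_iff_continuous_domRestrict]
    convert F.continuous using 1
    exact funext fun q => hsV q q.2
  obtain ⟨hF₁, hF₂⟩ := hF ⟨q, hq⟩
  rw [hsV q hq]
  refine ⟨hF₁, hF₂, fun t => ?_, ?_, ?_⟩
  · rcases le_total (t : ℝ) (1 / 2) with ht | ht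
    · rw [hF₁ t ht ⟨2 * t, by linarith [t.2.1], by linarith⟩ rfl]
      refine (hsigp _ hq.2 _).trans ?_
      rw [hj]
      rfl
    · rw [hF₂ t ht ⟨2 - 2 * t, by linarith [t.2.2], by linarith⟩ rfl]
      exact hLp _ (hpV q hq) _
  · rw [hF₁ 0 (by simp) 0 (by simp)]
    refine (hsig0 _ hq.2).trans ?_
    rw [hj]
  · rw [hF₂ 1 (by norm_num) 0 (by norm_num)]
    exact hL0 _ (hpV q hq)
end

section
/- Let p : E → B be a continuous map, L a lifting function for p, and s : E²_B → C(I,E) a parametrised motion planning algorithm on all of E²_B. For e ∈ E and ν ∈ C(I,E) with p(e) = p(ν(0)) (ν is the known motion of the target, consistent with the changing external conditions p ∘ ν), define γ̃(t) = s(L(e, p∘ν)(t), ν(t))(t). Then the pairs (L(e, p∘ν)(t), ν(t)) lie in E²_B so γ̃ is well defined, γ̃ is a continuous path in E satisfying p ∘ γ̃ = p ∘ ν, γ̃(0) = e, and γ̃(1) = ν(1); moreover the map (e, ν) ↦ γ̃ is continuous from E ×_B C(I,E) = {(e,ν) ∈ E × C(I,E) : p(e) = p(ν(0))} (with the subspace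 topology) to C(I,E). In other words, blending s and L yields an algorithm for navigation to a moving target. -/
open unitInterval

/-- navigation to a moving target: Let `p : E → B` be
continuous, `L` a lifting function for `p`, and `s` a parametrised motion
planning algorithm on all of `E²_B`.  For `e ∈ E` and a motion `ν ∈ C(I,E)`
of the target with `p e = p (ν 0)`, define
`γ̃(t) = s(L(e, p∘ν)(t), ν(t))(t)`.  Then the pairs `(L(e, p∘ν)(t), ν(t))`
lie in `E²_B` (so `γ̃` is well defined), `γ̃` is a continuous path with
`p ∘ γ̃ = p ∘ ν`, `γ̃(0) = e`, `γ̃(1) = ν(1)`, and `(e,ν) ↦ γ̃` is continuous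
on `E ×_B C(I,E) = {(e,ν) : p e = p (ν 0)}`. -/
theorem stmt_16 {E B : Type*} [TopologicalSpace E] [TopologicalSpace B]
    (p : E → B) (hp : Continuous p)
    -- the lifting function L
    (L : E × C(I, B) → C(I, E))
    (hLcont : ContinuousOn L {q | p q.1 = q.2 0})
    (hL0 : ∀ q : E × C(I, B), p q.1 = q.2 0 → L q 0 = q.1)
    (hLp : ∀ q : E × C(I, B), p q.1 = q.2 0 → ∀ t : I, p (L q t) = q.2 t)
    -- the parametrised motion planning algorithm s on all of E²_B
    (s : E × E → C(I, E))
    (hscont : ContinuousOn s {q : E × E | p q.1 = p q.2})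
    (hs0 : ∀ q : E × E, p q.1 = p q.2 → s q 0 = q.1)
    (hs1 : ∀ q : E × E, p q.1 = p q.2 → s q 1 = q.2)
    (hsp : ∀ q : E × E, p q.1 = p q.2 → ∀ t : I, p (s q t) = p q.1)
    -- the space E ×_B C(I,E) of inputs (current state, motion of the target)
    (D : Set (E × C(I, E)))
    (hD : D = {q : E × C(I, E) | p q.1 = p (q.2 0)})
    -- the blended algorithm γ̃
    (tilde : E × C(I, E) → C(I, E))
    (hdef : ∀ q ∈ D, ∀ t : I,
      tilde q t = s (L (q.1, (ContinuousMap.mk p hp).comp q.2) t, q.2 t) t) :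
    -- the pairs (L(e, p∘ν)(t), ν(t)) lie in E²_B, so γ̃ is well defined
    (∀ q ∈ D, ∀ t : I,
      p (L (q.1, (ContinuousMap.mk p hp).comp q.2) t) = p (q.2 t)) ∧
    -- γ̃ covers p ∘ ν
    (∀ q ∈ D, ∀ t : I, p (tilde q t) = p (q.2 t)) ∧
    -- γ̃ starts at the initial state e of the system
    (∀ q ∈ D, tilde q 0 = q.1) ∧
    -- γ̃ ends at the final state ν(1) of the target
    (∀ q ∈ D, tilde q 1 = q.2 1) ∧
    -- (e, ν) ↦ γ̃ is continuous on E ×_B C(I,E)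
    ContinuousOn tilde D := by
  subst hD
  have hmem : ∀ q ∈ {q : E × C(I, E) | p q.1 = p (q.2 0)}, ∀ t : I,
      p (L (q.1, (ContinuousMap.mk p hp).comp q.2) t) = p (q.2 t) :=
    fun q hq t => hLp (q.1, (ContinuousMap.mk p hp).comp q.2) hq t
  refine ⟨hmem, ?_, ?_, ?_, ?_⟩
  · intro q hq t
    rw [hdef q hq t, hsp _ (hmem q hq t) t]
    exact hmem q hq t
  · intro q hq
    rw [hdef q hq 0, hs0 _ (hmem q hq 0)]
    exact hL0 (q.1, (ContinuousMap.mk p hp).comp q.2) hq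
  · intro q hq
    rw [hdef q hq 1, hs1 _ (hmem q hq 1)]
  · rw [continuousOn_iff_continuous_domRestrict]
    refine ContinuousMap.continuous_of_continuous_uncurry _ ?_
    have hLift : Continuous fun q : {q : E × C(I, E) | p q.1 = p (q.2 0)} =>
        L (q.1.1, (ContinuousMap.mk p hp).comp q.1.2) := by
      refine hLcont.comp_continuous ?_ fun q => q.2
      exact (continuous_fst.comp continuous_subtype_val).prodMk
        ((ContinuousMap.continuous_postcomp _).comp
          (continuous_snd.comp continuous_subtype_val))
    have hpair : Continuous fun x : {q : E × C(I, E) | p q.1 = p (q.2 0)} × I =>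
        (L (x.1.1.1, (ContinuousMap.mk p hp).comp x.1.1.2) x.2, x.1.1.2 x.2) :=
      ((hLift.comp continuous_fst).eval continuous_snd).prodMk
        ((continuous_snd.comp (continuous_subtype_val.comp continuous_fst)).eval continuous_snd)
    refine ((hscont.comp_continuous hpair fun x => hmem x.1.1 x.1.2 x.2).eval
      continuous_snd).congr fun x => ?_
    exact (hdef x.1.1 x.1.2 x.2).symm
end
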